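/- Let f be a polynomial in ℝ[x₁,…,xₙ], ρ > 0, and let p = (x,s) ∈ V with s ≠ 0 be a non-isolated point of V. Suppose given δ > 0, a sequence (e_k) of positive reals with e_k → 0, and points a_k, b_k ∈ V_{e_k} ∪ V_{−e_k} lying, for each k, in the same connected component of V_{e_k} ∪ V_{−e_k}, with a_k → p and ‖b_k − p‖ ≥ δ for all k. Then there exist i ∈ {1,…,n}, δ' > 0, a subsequence (e_{k_j}), and points w_j ∈ Crit_i(e_{k_j}) ∪ Crit_i(−e_{k_j}) such that for every j, w_j lies in the connected component of a_{k_j} in V_{e_{k_j}} ∪ V_{−e_{k_j}} and ‖w_j − p‖ ≥ δ'. -/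

import Mathlib

open MvPolynomial Metric Filter Topology

/-- `ℝ^{n+1}` identified with `ℝⁿ × ℝ`, equipped with the Euclidean (L²) norm. -/
noncomputable abbrev EuclProd (n : ℕ) : Type :=
  WithLp 2 (EuclideanSpace ℝ (Fin n) × ℝ)

/-- The `ℝⁿ`-component of a point of `ℝⁿ × ℝ`. -/
noncomputable def xpart {n : ℕ} (p : EuclProd n) : EuclideanSpace ℝ (Fin n) :=
  (WithLp.equiv 2 (EuclideanSpace ℝ (Fin n) × ℝ) p).1

/-- The last (`ℝ`-)component of a point of `ℝⁿ × ℝ`. -/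
def spart {n : ℕ} (p : EuclProd n) : ℝ :=
  (WithLp.equiv 2 (EuclideanSpace ℝ (Fin n) × ℝ) p).2

/-- The level set `V_e = {(x,s) | f(x) = e, ‖x‖² + s² = ρ²}`. -/
noncomputable def levelV {n : ℕ} (f : MvPolynomial (Fin n) ℝ) (ρ e : ℝ) :
    Set (EuclProd n) :=
  {p : EuclProd n |
    MvPolynomial.eval (xpart p) f = e ∧ ‖xpart p‖ ^ 2 + (spart p) ^ 2 = ρ ^ 2}

/-- The vector `(∇f(x), 0) ∈ ℝⁿ × ℝ` at the point `p = (x,s)`. -/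
noncomputable def gradLift {n : ℕ} (f : MvPolynomial (Fin n) ℝ) (p : EuclProd n) :
    EuclProd n :=
  (WithLp.equiv 2 (EuclideanSpace ℝ (Fin n) × ℝ)).symm
    ((show EuclideanSpace ℝ (Fin n) from
        WithLp.toLp 2 fun j => MvPolynomial.eval (xpart p) (MvPolynomial.pderiv j f)), 0)

/-- The `i`-th standard basis vector `(eᵢ, 0)` of `ℝ^{n+1} = ℝⁿ × ℝ`, `1 ≤ i ≤ n`. -/
noncomputable def basisVec {n : ℕ} (i : Fin n) : EuclProd n :=
  (WithLp.equiv 2 (EuclideanSpace ℝ (Fin n) × ℝ)).symm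
    (EuclideanSpace.single i (1 : ℝ), 0)

/-- `Crit_i(e)`: critical points of the projection `πᵢ : (x,s) ↦ xᵢ` restricted to
`V_e`, i.e. points `p = (x,s) ∈ V_e` with `(eᵢ,0) ∈ span{(∇f(x),0), (x,s)}`. -/
noncomputable def critSet {n : ℕ} (f : MvPolynomial (Fin n) ℝ) (ρ : ℝ) (i : Fin n)
    (e : ℝ) : Set (EuclProd n) :=
  {p : EuclProd n | p ∈ levelV f ρ e ∧
    basisVec i ∈ Submodule.span ℝ ({gradLift f p, p} : Set (EuclProd n))}


open TensorProduct in
lemma isAlgebraic_of_D_eq_zero {K : Type} [Field K] [Algebra ℝ K] (t : K)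
    (h : KaehlerDifferential.D ℝ K t = 0) : IsAlgebraic ℝ t := by
  by_contra ht
  have hi : AlgebraicIndepOn ℝ id ({t} : Set K) := by
    have : AlgebraicIndependent ℝ (fun _ : ({t} : Set K) => t) :=
      (algebraicIndependent_unique_type_iff).2 ht
    convert this using 1
    ext ⟨x, hx⟩
    exact hx
  obtain ⟨B, hB, hB'⟩ := exists_isTranscendenceBasis_superset hi
  let S := MvPolynomial B ℝ
  let : Algebra S K := (aeval (R := ℝ) (fun b : B => (b : K))).toAlgebra
  have hmap : ∀ s : S, algebraMap S K s = aeval (R := ℝ) (fun b : B => (b : K)) s := fun _ => rfl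
  have : IsScalarTower ℝ S K := .of_algebraMap_eq fun x => by
    rw [hmap, MvPolynomial.algebraMap_eq, aeval_C]
  have hinj : Function.Injective (algebraMap S K) := hB'.1
  have : FaithfulSMul S K := (faithfulSMul_iff_algebraMap_injective S K).2 hinj
  let : Algebra (FractionRing S) K := FractionRing.liftAlgebra S K
  have : IsScalarTower S (FractionRing S) K := FractionRing.isScalarTower_liftAlgebra S K
  have : Algebra.IsAlgebraic S K := by
    have h1 := hB'.isAlgebraic
    constructor
    intro a
    obtain ⟨q, hq0, hq⟩ := h1.1 a
    let E := hB'.1.aevalEquiv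
    refine ⟨q.map (E.symm : _ →+* S), ?_, ?_⟩
    · rwa [Ne, Polynomial.map_eq_zero_iff]
      exact E.symm.injective
    · rw [Polynomial.aeval_def, Polynomial.eval₂_map]
      rw [Polynomial.aeval_def] at hq
      convert hq using 2
      ext x
      simp only [RingHom.comp_apply]
      obtain ⟨y, rfl⟩ := E.surjective x
      simp [E, hmap]
  have : Algebra.IsAlgebraic (FractionRing S) K :=
    Algebra.IsAlgebraic.extendScalars (IsFractionRing.injective S (FractionRing S))
  have : CharZero (FractionRing S) := inferInstance
  have : Algebra.FormallyEtale (FractionRing S) K := Algebra.FormallyEtale.of_isSeparable _ K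
  have : Algebra.FormallyEtale S (FractionRing S) :=
    Algebra.FormallyEtale.of_isLocalization (nonZeroDivisors S)
  have : Algebra.FormallyEtale S K := Algebra.FormallyEtale.comp S (FractionRing S) K
  let b : B := ⟨t, hB rfl⟩
  have e1 := KaehlerDifferential.tensorKaehlerEquivOfFormallyEtale_symm_D_algebraMap ℝ S K (X b)
  rw [hmap, aeval_X, h, map_zero] at e1
  have e2 : ((KaehlerDifferential.mvPolynomialBasis ℝ B).baseChange K) b = 0 := by
    rw [Module.Basis.baseChange_apply, KaehlerDifferential.mvPolynomialBasis_apply]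
    exact e1.symm
  exact Module.Basis.ne_zero _ b e2

lemma D_aeval {n : ℕ} {K : Type} [Field K] [Algebra ℝ K] (y : Fin n → K)
    (f : MvPolynomial (Fin n) ℝ) :
    KaehlerDifferential.D ℝ K (aeval y f) =
      ∑ j, aeval y (pderiv j f) • KaehlerDifferential.D ℝ K (y j) := by
  induction f using MvPolynomial.induction_on with
  | C a => simp
  | add p q hp hq => simp [hp, hq, add_smul, Finset.sum_add_distrib]
  | mul_X p i hp =>
    simp only [map_mul, aeval_X, Derivation.leibniz, hp, smul_eq_mul, map_add,
      add_smul, Finset.sum_add_distrib, pderiv_X, Finset.smul_sum, smul_smul]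
    congr 1
    rw [Finset.sum_eq_single i]
    · simp
    · intro j _ hj
      simp [hj.symm]
    · simp

/-- Algebraic Sard principle. -/
lemma alg_sard {n : ℕ} (f : MvPolynomial (Fin n) ℝ) (J : Ideal (MvPolynomial (Fin n) ℝ))
    (H : ∀ (K : Type) [Field K] [Algebra ℝ K] (y : Fin n → K), (∀ g ∈ J, aeval y g = 0) →
      KaehlerDifferential.D ℝ K (aeval y f) = 0) :
    ∃ q : Polynomial ℝ, q ≠ 0 ∧ ∀ x : Fin n → ℝ, (∀ g ∈ J, eval x g = 0) →
      q.eval (eval x f) = 0 := by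
  have key : ∀ P ∈ J.minimalPrimes, ∃ q : Polynomial ℝ, q ≠ 0 ∧ Polynomial.aeval f q ∈ P := by
    intro P hP
    have : P.IsPrime := hP.1.1
    let A := MvPolynomial (Fin n) ℝ ⧸ P
    let K := FractionRing A
    let φ : MvPolynomial (Fin n) ℝ →ₐ[ℝ] K :=
      (IsScalarTower.toAlgHom ℝ A K).comp (Ideal.Quotient.mkₐ ℝ P)
    have hφ : ∀ g, φ g = 0 ↔ g ∈ P := by
      intro g
      have : φ g = algebraMap A K (Ideal.Quotient.mk P g) := rfl
      rw [this, map_eq_zero_iff _ (IsFractionRing.injective A K), Ideal.Quotient.eq_zero_iff_mem]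
    have hae : ∀ g, aeval (fun i => φ (X i)) g = φ g := by
      intro g
      rw [show (fun i => φ (X i)) = φ ∘ X from rfl, ← MvPolynomial.aeval_unique]
    have h := H K (fun i => φ (X i)) (fun g hg => by rw [hae, hφ]; exact hP.1.2 hg)
    obtain ⟨q, hq0, hq⟩ := isAlgebraic_of_D_eq_zero _ h
    refine ⟨q, hq0, ?_⟩
    rw [← hφ, ← Polynomial.aeval_algHom_apply, ← hae f]
    exact hq
  choose! q hq0 hq using key
  have hfin := Ideal.finite_minimalPrimes_of_isNoetherianRing (MvPolynomial (Fin n) ℝ) J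
  refine ⟨∏ P ∈ hfin.toFinset, q P, ?_, ?_⟩
  · rw [Finset.prod_ne_zero_iff]
    intro P hP
    exact hq0 P (by simpa using hP)
  · intro x hx
    let m : Ideal (MvPolynomial (Fin n) ℝ) := RingHom.ker (eval x)
    have : m.IsPrime := RingHom.ker_isPrime _
    obtain ⟨P, hP, hPm⟩ := Ideal.exists_minimalPrimes_le (I := J) (J := m) (fun g hg => hx g hg)
    rw [Polynomial.eval_prod, Finset.prod_eq_zero_iff]
    refine ⟨P, by simpa using hP, ?_⟩
    have h1 : eval x (Polynomial.aeval f (q P)) = 0 := hPm (hq P hP)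
    have h2 : (aeval x : MvPolynomial (Fin n) ℝ →ₐ[ℝ] ℝ) (Polynomial.aeval f (q P)) = 0 := h1
    rw [← Polynomial.aeval_algHom_apply] at h2
    exact h2

lemma sard_grad {n : ℕ} (f : MvPolynomial (Fin n) ℝ) :
    ∃ q : Polynomial ℝ, q ≠ 0 ∧ ∀ x : Fin n → ℝ, (∀ j, eval x (pderiv j f) = 0) →
      q.eval (eval x f) = 0 := by
  obtain ⟨q, hq0, hq⟩ := alg_sard f (Ideal.span (Set.range fun j => pderiv j f)) (by
    intro K _ _ y hy
    rw [D_aeval]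
    refine Finset.sum_eq_zero fun j _ => ?_
    rw [hy _ (Ideal.subset_span ⟨j, rfl⟩), zero_smul])
  refine ⟨q, hq0, fun x hx => hq x fun g hg => ?_⟩
  have : Ideal.span (Set.range fun j => pderiv j f) ≤ RingHom.ker (eval x) := by
    rw [Ideal.span_le]
    rintro _ ⟨j, rfl⟩
    exact hx j
  exact this hg

lemma sard_sphere {n : ℕ} (f : MvPolynomial (Fin n) ℝ) (ρ : ℝ) (hρ : 0 < ρ) :
    ∃ q : Polynomial ℝ, q ≠ 0 ∧ ∀ x : Fin n → ℝ, ∑ j, x j ^ 2 = ρ ^ 2 →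
      (∃ c, ∀ j, eval x (pderiv j f) = c * x j) → q.eval (eval x f) = 0 := by
  let G : Set (MvPolynomial (Fin n) ℝ) :=
    insert (∑ j, X j ^ 2 - C (ρ ^ 2))
      (Set.range fun ij : Fin n × Fin n => X ij.1 * pderiv ij.2 f - X ij.2 * pderiv ij.1 f)
  obtain ⟨q, hq0, hq⟩ := alg_sard f (Ideal.span G) (by
    intro K _ _ y hy
    have h1 := hy _ (Ideal.subset_span (Set.mem_insert _ _))
    have h2 : ∀ i j, y i * aeval y (pderiv j f) = y j * aeval y (pderiv i f) := by
      intro i j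
      have := hy _ (Ideal.subset_span (Set.mem_insert_of_mem _ ⟨(i, j), rfl⟩))
      simpa [sub_eq_zero] using this
    simp only [map_sub, map_sum, map_pow, aeval_X, aeval_C, sub_eq_zero] at h1
    have h3 : ∑ j, y j • KaehlerDifferential.D ℝ K (y j) = 0 := by
      have := congrArg (KaehlerDifferential.D ℝ K) h1
      rw [← map_pow, Derivation.map_algebraMap, map_sum] at this
      simp only [Derivation.leibniz_pow] at this
      have h4 : (2 : K) • ∑ j, y j • KaehlerDifferential.D ℝ K (y j) = 0 := by
        rw [← this, Finset.smul_sum]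
        refine Finset.sum_congr rfl fun j _ => ?_
        simp [ofNat_smul_eq_nsmul]
      have : CharZero K := charZero_of_injective_algebraMap (algebraMap ℝ K).injective
      exact (smul_eq_zero.1 h4).resolve_left two_ne_zero
    have h5 : (algebraMap ℝ K ρ ^ 2) • KaehlerDifferential.D ℝ K (aeval y f) = 0 := by
      rw [← h1, D_aeval, Finset.sum_smul]
      simp only [Finset.smul_sum, smul_smul]
      calc _ = ∑ i, ∑ j, (y i * aeval y (pderiv i f)) • (y j • KaehlerDifferential.D ℝ K (y j)) := by
            refine Finset.sum_congr rfl fun i _ => Finset.sum_congr rfl fun j _ => ?_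
            rw [smul_smul, sq, mul_assoc, h2 i j]
            congr 1
            ring
        _ = 0 := by simp only [← Finset.smul_sum, h3, smul_zero, Finset.sum_const_zero]
    refine (smul_eq_zero.1 h5).resolve_left (pow_ne_zero _ ?_)
    simpa using hρ.ne')
  refine ⟨q, hq0, fun x hx hc => hq x fun g hg => ?_⟩
  have : Ideal.span G ≤ RingHom.ker (eval x) := by
    rw [Ideal.span_le]
    rintro _ (rfl | ⟨⟨i, j⟩, rfl⟩)
    · simp [RingHom.mem_ker, hx]
    · obtain ⟨c, hc⟩ := hc
      simp [RingHom.mem_ker, hc]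
      ring
  exact this hg

lemma xpart_apply {n : ℕ} (p : EuclProd n) : xpart p = p.fst := rfl

lemma norm_sq_parts {n : ℕ} (p : EuclProd n) : ‖xpart p‖ ^ 2 + (spart p) ^ 2 = ‖p‖ ^ 2 := by
  rw [WithLp.prod_norm_sq_eq_of_L2]
  simp [xpart, spart]

lemma inner_basisVec {n : ℕ} (j : Fin n) (q : EuclProd n) :
    inner ℝ (basisVec j) q = xpart q j := by
  rw [WithLp.prod_inner_apply]
  simp only [xpart, basisVec, WithLp.equiv_symm_apply, inner_zero_left, add_zero,
    EuclideanSpace.inner_single_left]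
  simp

lemma xpart_add {n : ℕ} (p q : EuclProd n) : xpart (p + q) = xpart p + xpart q := rfl
lemma xpart_sub {n : ℕ} (p q : EuclProd n) : xpart (p - q) = xpart p - xpart q := rfl
lemma xpart_smul {n : ℕ} (c : ℝ) (q : EuclProd n) : xpart (c • q) = c • xpart q := rfl
lemma spart_add {n : ℕ} (p q : EuclProd n) : spart (p + q) = spart p + spart q := rfl
lemma spart_sub {n : ℕ} (p q : EuclProd n) : spart (p - q) = spart p - spart q := rfl
lemma spart_smul {n : ℕ} (c : ℝ) (q : EuclProd n) : spart (c • q) = c * spart q := rfl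
lemma xpart_gradLift {n : ℕ} (f : MvPolynomial (Fin n) ℝ) (p : EuclProd n) (j : Fin n) :
    xpart (gradLift f p) j = eval (xpart p) (pderiv j f) := rfl
lemma spart_gradLift {n : ℕ} (f : MvPolynomial (Fin n) ℝ) (p : EuclProd n) :
    spart (gradLift f p) = 0 := rfl

lemma inner_gradLift {n : ℕ} (f : MvPolynomial (Fin n) ℝ) (p q : EuclProd n) :
    inner ℝ (gradLift f p) q = ∑ j, eval (xpart p) (pderiv j f) * xpart q j := by
  rw [WithLp.prod_inner_apply]
  simp [gradLift, xpart, PiLp.inner_apply, mul_comm]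

lemma continuous_xpart {n : ℕ} : Continuous (xpart : EuclProd n → _) :=
  WithLp.prod_continuous_ofLp 2 _ _ |>.fst
lemma continuous_spart {n : ℕ} : Continuous (spart : EuclProd n → _) :=
  WithLp.prod_continuous_ofLp 2 _ _ |>.snd

lemma continuous_xcoord {n : ℕ} (i : Fin n) : Continuous (fun q : EuclProd n => xpart q i) := by
  simp_rw [← inner_basisVec]
  fun_prop

lemma hasStrictFDerivAt_coord {n : ℕ} (j : Fin n) (w : EuclProd n) :
    HasStrictFDerivAt (fun q : EuclProd n => xpart q j) (innerSL ℝ (basisVec j)) w := by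
  have : (fun q : EuclProd n => xpart q j) = innerSL ℝ (basisVec j) := by
    ext q
    rw [innerSL_apply_apply, inner_basisVec]
  rw [this]
  exact (innerSL ℝ (basisVec j)).hasStrictFDerivAt

lemma hasStrictFDerivAt_eval {n : ℕ} (f : MvPolynomial (Fin n) ℝ) (w : EuclProd n) :
    HasStrictFDerivAt (fun q : EuclProd n => eval (xpart q) f) (innerSL ℝ (gradLift f w)) w := by
  have h : ∀ g : MvPolynomial (Fin n) ℝ,
      HasStrictFDerivAt (fun q : EuclProd n => eval (xpart q) g)
        (innerSL ℝ (gradLift g w)) w := by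
    intro g
    induction g using MvPolynomial.induction_on with
    | C a =>
      have : innerSL ℝ (gradLift (C a) w) = 0 := by
        refine ContinuousLinearMap.ext fun q => ?_
        rw [innerSL_apply_apply, inner_gradLift]
        simp
      rw [this]
      simpa using hasStrictFDerivAt_const a w
    | add p q hp hq =>
      have : innerSL ℝ (gradLift (p + q) w) =
          innerSL ℝ (gradLift p w) + innerSL ℝ (gradLift q w) := by
        refine ContinuousLinearMap.ext fun v => ?_
        rw [add_apply]
        simp only [innerSL_apply_apply, inner_gradLift, map_add, add_mul, Finset.sum_add_distrib]
      rw [this]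
      simpa using! hp.add hq
    | mul_X p i hp =>
      have h1 := hp.mul (hasStrictFDerivAt_coord i w)
      have h2 : innerSL ℝ (gradLift (p * X i) w) = eval (xpart w) p • innerSL ℝ (basisVec i) +
          xpart w i • innerSL ℝ (gradLift p w) := by
        refine ContinuousLinearMap.ext fun v => ?_
        rw [add_apply, smul_apply, smul_apply]
        simp only [innerSL_apply_apply, inner_gradLift, Derivation.leibniz, smul_eq_mul, map_add,
          map_mul, eval_X, add_mul, Finset.sum_add_distrib, inner_basisVec, Finset.mul_sum]
        congr 1
        · rw [Finset.sum_eq_single i]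
          · simp
          · intro j _ hj
            simp [pderiv_X_of_ne hj.symm]
          · simp
        · simp only [mul_assoc]
      rw [h2]
      simp only [map_mul, eval_X]
      exact h1
  exact h f

lemma exists_curve {n : ℕ} (f : MvPolynomial (Fin n) ℝ) (ρ e : ℝ) (i : Fin n) (w : EuclProd n)
    (hw : w ∈ levelV f ρ e)
    (hreg : ∀ α β : ℝ, α • gradLift f w + β • w = 0 → α = 0 ∧ β = 0)
    (hcrit : basisVec i ∉ Submodule.span ℝ ({gradLift f w, w} : Set (EuclProd n))) :
    ∃ ε > 0, ∃ c : ℝ → EuclProd n, ContinuousOn c (Set.Ioo (-ε) ε) ∧ c 0 = w ∧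
      ∀ t ∈ Set.Ioo (-ε) ε, c t ∈ levelV f ρ e ∧ xpart (c t) i = xpart w i + t := by
  let F : EuclProd n → ℝ × ℝ × ℝ := fun q => (eval (xpart q) f, ‖q‖ ^ 2, xpart q i)
  let F' : EuclProd n →L[ℝ] ℝ × ℝ × ℝ :=
    (innerSL ℝ (gradLift f w)).prod ((2 • innerSL ℝ w).prod (innerSL ℝ (basisVec i)))
  have hF : HasStrictFDerivAt F F' w :=
    (hasStrictFDerivAt_eval f w).prodMk
      ((hasStrictFDerivAt_norm_sq w).prodMk (hasStrictFDerivAt_coord i w))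
  have hsurj : F'.range = ⊤ := by
    by_contra hne
    obtain ⟨φ, hφ0, hφ⟩ := Submodule.exists_le_ker_of_lt_top _ (lt_top_iff_ne_top.2 hne)
    have hφe : ∀ y : ℝ × ℝ × ℝ, φ y = φ (1, 0, 0) * y.1 + φ (0, 1, 0) * y.2.1
        + φ (0, 0, 1) * y.2.2 := by
      rintro ⟨y1, y2, y3⟩
      have : ((y1, y2, y3) : ℝ × ℝ × ℝ) = y1 • (1, 0, 0) + y2 • (0, 1, 0) + y3 • (0, 0, 1) := by
        simp
      rw [this, map_add, map_add, map_smul, map_smul, map_smul]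
      simp
      ring
    set A := φ (1, 0, 0)
    set B := φ (0, 1, 0)
    set D := φ (0, 0, 1)
    have hsum : A • gradLift f w + (2 * B) • w + D • basisVec i = 0 := by
      rw [← inner_self_eq_zero (𝕜 := ℝ)]
      set v := A • gradLift f w + (2 * B) • w + D • basisVec i with hv
      have h1 : φ (F' v) = 0 := hφ ⟨v, rfl⟩
      rw [hφe] at h1
      have h2 : F' v = (inner ℝ (gradLift f w) v, 2 * inner ℝ w v, inner ℝ (basisVec i) v) := by
        simp [F']
        ring
      rw [h2] at h1
      conv_lhs => rw [hv]
      rw [← hv, inner_add_left, inner_add_left, inner_smul_left, inner_smul_left, inner_smul_left]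
      simp only [conj_trivial]
      linarith
    by_cases hD : D = 0
    · rw [hD, zero_smul, add_zero] at hsum
      obtain ⟨hA, hB⟩ := hreg _ _ hsum
      apply hφ0
      refine LinearMap.ext fun y => ?_
      rw [hφe, hA, hD, show B = 0 by linarith]
      simp
    · apply hcrit
      rw [Submodule.mem_span_pair]
      refine ⟨-(A / D), -(2 * B / D), ?_⟩
      have : basisVec i = D⁻¹ • (D • basisVec i : EuclProd n) := by
        rw [smul_smul, inv_mul_cancel₀ hD, one_smul]
      rw [this, eq_neg_of_add_eq_zero_right hsum]
      simp only [smul_neg, smul_add, smul_smul, neg_smul, neg_add]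
      congr 3 <;> ring
  let Φ := hF.implicitToOpenPartialHomeomorph F F' hsurj
  let γ : ℝ → (ℝ × ℝ × ℝ) × F'.ker := fun t => (F w + (0, 0, t), 0)
  have hγ : Continuous γ := by fun_prop
  have hγ0 : γ 0 = (F w, 0) := by simp [γ]
  have hΦw : Φ w = (F w, 0) := hF.implicitToOpenPartialHomeomorph_self hsurj
  have hT : γ ⁻¹' Φ.target ∈ 𝓝 (0 : ℝ) := by
    refine hγ.continuousAt.preimage_mem_nhds (Φ.open_target.mem_nhds ?_)
    rw [hγ0]
    exact hF.mem_implicitToOpenPartialHomeomorph_target hsurj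
  obtain ⟨ε, hε, hball⟩ := Metric.mem_nhds_iff.1 hT
  rw [Real.ball_eq_Ioo, zero_sub, zero_add] at hball
  refine ⟨ε, hε, fun t => Φ.symm (γ t), ?_, ?_, ?_⟩
  · exact Φ.continuousOn_symm.comp hγ.continuousOn hball
  · change Φ.symm (γ 0) = w
    rw [hγ0, ← hΦw]
    exact Φ.left_inv (hF.mem_implicitToOpenPartialHomeomorph_source hsurj)
  · intro t ht
    have h1 : F (Φ.symm (γ t)) = F w + (0, 0, t) := by
      rw [← hF.implicitToOpenPartialHomeomorph_fst hsurj]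
      change (Φ (Φ.symm (γ t))).1 = _
      rw [Φ.right_inv (hball ht)]
    have h2 := congrArg Prod.fst h1
    have h3 := congrArg (fun z => z.2.1) h1
    have h4 := congrArg (fun z => z.2.2) h1
    simp only [F, Prod.fst_add, Prod.snd_add, add_zero] at h2 h3 h4
    refine ⟨⟨?_, ?_⟩, h4⟩
    · rw [h2]; exact hw.1
    · rw [norm_sq_parts, h3, ← norm_sq_parts]; exact hw.2

lemma isCompact_levelV {n : ℕ} (f : MvPolynomial (Fin n) ℝ) (ρ e : ℝ) :
    IsCompact (levelV f ρ e) := by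
  refine Metric.isCompact_of_isClosed_isBounded ?_ ?_
  · have h1 : Continuous fun q : EuclProd n => eval (xpart q) f :=
      (MvPolynomial.continuous_eval f).comp (continuous_pi fun i => continuous_xcoord i)
    have h2 : Continuous fun q : EuclProd n => ‖xpart q‖ ^ 2 + spart q ^ 2 :=
      (continuous_xpart.norm.pow 2).add (continuous_spart.pow 2)
    have h3 : levelV f ρ e = {q : EuclProd n | eval (xpart q) f = e} ∩
        {q : EuclProd n | ‖xpart q‖ ^ 2 + spart q ^ 2 = ρ ^ 2} := Set.ext fun q => Iff.rfl
    rw [h3]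
    exact (isClosed_eq h1 continuous_const).inter (isClosed_eq h2 continuous_const)
  · refine (Metric.isBounded_closedBall (x := (0 : EuclProd n)) (r := |ρ|)).subset ?_
    intro q hq
    rw [mem_closedBall_zero_iff]
    have := hq.2
    rw [norm_sq_parts] at this
    exact le_of_eq (by simpa using (sq_eq_sq_iff_abs_eq_abs _ _).1 this)

lemma isCompact_connectedComponentIn {X : Type*} [TopologicalSpace X] {F : Set X}
    (hF : IsCompact F) {x : X} (hx : x ∈ F) : IsCompact (connectedComponentIn F x) := by
  rw [connectedComponentIn_eq_image hx]
  have := isCompact_iff_compactSpace.1 hF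
  exact isClosed_connectedComponent.isCompact.image continuous_subtype_val

lemma exists_sing_poly {n : ℕ} (f : MvPolynomial (Fin n) ℝ) (ρ : ℝ) (hρ : 0 < ρ) :
    ∃ q : Polynomial ℝ, q ≠ 0 ∧ ∀ e, q.eval e ≠ 0 → ∀ w ∈ levelV f ρ e,
      ∀ α β : ℝ, α • gradLift f w + β • w = 0 → α = 0 ∧ β = 0 := by
  obtain ⟨q1, h10, h1⟩ := sard_grad f
  obtain ⟨q2, h20, h2⟩ := sard_sphere f ρ hρ
  refine ⟨q1 * q2, mul_ne_zero h10 h20, fun e he w hw α β h => ?_⟩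
  rw [Polynomial.eval_mul, mul_ne_zero_iff] at he
  have hx : ∀ j, α * eval (xpart w) (pderiv j f) + β * xpart w j = 0 := by
    intro j
    have := congrArg (fun z => xpart z j) h
    simpa [xpart_add, xpart_smul, xpart_gradLift] using! this
  have hs : β * spart w = 0 := by
    have := congrArg spart h
    rw [spart_add, spart_smul, spart_smul, spart_gradLift, mul_zero, zero_add] at this
    exact this
  have hw0 : w ≠ 0 := by
    rintro rfl
    have := hw.2
    rw [norm_sq_parts] at this
    simp at this
    exact (pow_pos hρ 2).ne this
  by_cases hα : α = 0
  · refine ⟨hα, ?_⟩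
    rw [hα, zero_smul, zero_add] at h
    exact (smul_eq_zero.1 h).resolve_right hw0
  · exfalso
    by_cases hβ : β = 0
    · apply he.1
      rw [← hw.1]
      refine h1 _ fun j => ?_
      have := hx j
      rw [hβ, zero_mul, add_zero] at this
      exact (mul_eq_zero.1 this).resolve_left hα
    · apply he.2
      rw [← hw.1]
      refine h2 _ ?_ ⟨-(β / α), fun j => ?_⟩
      · have h3 := hw.2
        rw [(mul_eq_zero.1 hs).resolve_left hβ, EuclideanSpace.norm_sq_eq] at h3
        simpa using h3
      · have := hx j
        field_simp
        linarith

lemma extr_mem_crit {n : ℕ} (f : MvPolynomial (Fin n) ℝ) (ρ e : ℝ) (U : Set (EuclProd n))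
    (hU : levelV f ρ e ⊆ U) (i : Fin n) (a w : EuclProd n)
    (hw : w ∈ levelV f ρ e) (hwC : w ∈ connectedComponentIn U a)
    (hreg : ∀ α β : ℝ, α • gradLift f w + β • w = 0 → α = 0 ∧ β = 0)
    (hext : (∀ y ∈ connectedComponentIn U a, xpart y i ≤ xpart w i) ∨
      (∀ y ∈ connectedComponentIn U a, xpart w i ≤ xpart y i)) :
    w ∈ critSet f ρ i e := by
  refine ⟨hw, ?_⟩
  by_contra hcrit
  obtain ⟨ε, hε, c, hc, hc0, hcV⟩ := exists_curve f ρ e i w hw hreg hcrit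
  have h0 : (0 : ℝ) ∈ Set.Ioo (-ε) ε := by constructor <;> linarith
  have hsub : c '' Set.Ioo (-ε) ε ⊆ connectedComponentIn U a := by
    rw [connectedComponentIn_eq hwC]
    refine (isPreconnected_Ioo.image c hc).subset_connectedComponentIn ⟨0, h0, hc0⟩ ?_
    rintro _ ⟨t, ht, rfl⟩
    exact hU (hcV t ht).1
  rcases hext with h | h
  · have ht : ε / 2 ∈ Set.Ioo (-ε) ε := by constructor <;> linarith
    have := h _ (hsub ⟨_, ht, rfl⟩)
    rw [(hcV _ ht).2] at this
    linarith
  · have ht : -(ε / 2) ∈ Set.Ioo (-ε) ε := by constructor <;> linarith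
    have := h _ (hsub ⟨_, ht, rfl⟩)
    rw [(hcV _ ht).2] at this
    linarith

lemma abs_coord_le {n : ℕ} (q : EuclProd n) (i : Fin n) : |xpart q i| ≤ ‖q‖ := by
  have h1 : ‖xpart q i‖ ≤ ‖xpart q‖ := PiLp.norm_apply_le _ _
  have h2 : ‖xpart q‖ ^ 2 ≤ ‖q‖ ^ 2 := by
    rw [← norm_sq_parts]
    nlinarith [sq_nonneg (spart q)]
  exact h1.trans ((le_abs_self _).trans (abs_le_of_sq_le_sq h2 (norm_nonneg _)))

/-- If `p = (x,s) ∈ V` with `s ≠ 0` is non-isolated, as witnessed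
by `δ > 0`, positive reals `e_k → 0` and points `a_k, b_k` in the same connected
component of `V_{e_k} ∪ V_{−e_k}` with `a_k → p` and `‖b_k − p‖ ≥ δ`, then for
some coordinate `i`, some `δ' > 0` and some subsequence, there are critical
points `w_j ∈ Crit_i(e_{k_j}) ∪ Crit_i(−e_{k_j})` lying in the connected
component of `a_{k_j}` and staying at distance `≥ δ'` from `p`. -/
theorem critical_witness_in_component
    (n : ℕ) (hn : 1 ≤ n) (f : MvPolynomial (Fin n) ℝ)
    (ρ : ℝ) (hρ : 0 < ρ)
    (p : EuclProd n) (hp : p ∈ levelV f ρ 0) (hs : spart p ≠ 0)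
    (hnotiso : ¬ ∃ r > 0, Metric.ball p r ∩ levelV f ρ 0 = {p})
    (δ : ℝ) (hδ : 0 < δ) (e : ℕ → ℝ) (he : ∀ k, 0 < e k)
    (he0 : Tendsto e atTop (𝓝 0))
    (a b : ℕ → EuclProd n)
    (ha : ∀ k, a k ∈ levelV f ρ (e k) ∪ levelV f ρ (-(e k)))
    (hb : ∀ k, b k ∈ levelV f ρ (e k) ∪ levelV f ρ (-(e k)))
    (hconn : ∀ k, b k ∈ connectedComponentIn
        (levelV f ρ (e k) ∪ levelV f ρ (-(e k))) (a k))
    (halim : Tendsto a atTop (𝓝 p))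
    (hbfar : ∀ k, δ ≤ ‖b k - p‖) :
    ∃ i : Fin n, ∃ δ' > (0 : ℝ), ∃ φ : ℕ → ℕ, StrictMono φ ∧
      ∃ w : ℕ → EuclProd n, ∀ j : ℕ,
        w j ∈ critSet f ρ i (e (φ j)) ∪ critSet f ρ i (-(e (φ j))) ∧
        w j ∈ connectedComponentIn
          (levelV f ρ (e (φ j)) ∪ levelV f ρ (-(e (φ j)))) (a (φ j)) ∧
        δ' ≤ ‖w j - p‖ := by
  by_contra hcon
  push Not at hcon
  set U : ℕ → Set (EuclProd n) := fun k => levelV f ρ (e k) ∪ levelV f ρ (-(e k)) with hU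
  set Cc : ℕ → Set (EuclProd n) := fun k => connectedComponentIn (U k) (a k) with hCc
  have hCU : ∀ k, Cc k ⊆ U k := fun k => connectedComponentIn_subset _ _
  have haC : ∀ k, a k ∈ Cc k := fun k => mem_connectedComponentIn (ha k)
  have hcomp : ∀ k, IsCompact (Cc k) := fun k =>
    isCompact_connectedComponentIn ((isCompact_levelV f ρ _).union (isCompact_levelV f ρ _)) (ha k)
  -- critical points converge to `p`
  have hclose : ∀ (i : Fin n) (δ' : ℝ), 0 < δ' → ∀ᶠ k in atTop, ∀ w ∈ Cc k,
      w ∈ critSet f ρ i (e k) ∪ critSet f ρ i (-(e k)) → ‖w - p‖ < δ' := by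
    intro i δ' hδ'
    by_contra hno
    have hfr : ∃ᶠ k in atTop, ∃ w ∈ Cc k,
        w ∈ critSet f ρ i (e k) ∪ critSet f ρ i (-(e k)) ∧ δ' ≤ ‖w - p‖ := by
      refine (not_eventually.1 hno).mono fun k hk => ?_
      push Not at hk
      exact hk
    obtain ⟨φ, hφ, hw⟩ := extraction_of_frequently_atTop hfr
    choose w hw1 hw2 hw3 using hw
    obtain ⟨j, hj⟩ := hcon i δ' hδ' φ hφ w
    exact absurd (hj (hw2 j) (hw1 j)) (not_lt.2 (hw3 j))
  -- regularity of the values for large `k`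
  obtain ⟨q, hq0, hq⟩ := exists_sing_poly f ρ hρ
  have hroot : ∀ᶠ t in 𝓝 (0 : ℝ), t ≠ 0 → q.eval t ≠ 0 := by
    have hfin : {t : ℝ | q.eval t = 0 ∧ t ≠ 0}.Finite :=
      (q.rootSet_finite ℝ).subset fun t ht => by
        rw [Polynomial.mem_rootSet]
        exact ⟨hq0, by simpa using ht.1⟩
    filter_upwards [hfin.isClosed.isOpen_compl.mem_nhds (x := (0 : ℝ)) (by simp)] with t ht h0 h1
    exact ht ⟨h1, h0⟩
  have hreg : ∀ᶠ k in atTop, q.eval (e k) ≠ 0 ∧ q.eval (-(e k)) ≠ 0 := by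
    have he0' : Tendsto (fun k => -(e k)) atTop (𝓝 0) := by simpa using he0.neg
    filter_upwards [he0.eventually hroot, he0'.eventually hroot] with k h1 h2
    exact ⟨h1 (he k).ne', h2 (neg_ne_zero.2 (he k).ne')⟩
  -- coordinates converge uniformly on the components
  have hcoord : ∀ (i : Fin n) (η : ℝ), 0 < η → ∀ᶠ k in atTop, ∀ y ∈ Cc k,
      |xpart y i - xpart p i| < η := by
    intro i η hη
    filter_upwards [hclose i η hη, hreg] with k hk hr y hy
    have hext : ∀ w ∈ Cc k, ((∀ y ∈ Cc k, xpart y i ≤ xpart w i) ∨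
        (∀ y ∈ Cc k, xpart w i ≤ xpart y i)) → |xpart w i - xpart p i| < η := by
      intro w hw hext
      refine lt_of_le_of_lt (abs_coord_le (w - p) i) (hk w hw ?_)
      rcases hCU k hw with h | h
      · exact Or.inl (extr_mem_crit f ρ _ (U k) Set.subset_union_left i (a k) w h hw
          (hq _ hr.1 w h) hext)
      · exact Or.inr (extr_mem_crit f ρ _ (U k) Set.subset_union_right i (a k) w h hw
          (hq _ hr.2 w h) hext)
    obtain ⟨M, hM, hMax⟩ := (hcomp k).exists_isMaxOn ⟨_, haC k⟩ (continuous_xcoord i).continuousOn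
    obtain ⟨m, hm, hMin⟩ := (hcomp k).exists_isMinOn ⟨_, haC k⟩ (continuous_xcoord i).continuousOn
    have h1 := abs_lt.1 (hext M hM (Or.inl fun y hy => hMax hy))
    have h2 := abs_lt.1 (hext m hm (Or.inr fun y hy => hMin hy))
    have h3 : xpart y i ≤ xpart M i := hMax hy
    have h4 : xpart m i ≤ xpart y i := hMin hy
    rw [abs_lt]
    constructor <;> linarith
  have hseq : ∀ y : ℕ → EuclProd n, (∀ k, y k ∈ Cc k) →
      Tendsto (fun k => xpart (y k)) atTop (𝓝 (xpart p)) := by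
    intro y hy
    have h1 : Tendsto (fun k => (xpart (y k)).ofLp) atTop (𝓝 (xpart p).ofLp) := by
      rw [tendsto_pi_nhds]
      intro i
      rw [Metric.tendsto_atTop']
      intro η hη
      obtain ⟨N, hN⟩ := eventually_atTop.1 (hcoord i η hη)
      exact ⟨N, fun k hk => hN k hk.le (y k) (hy k)⟩
    exact ((PiLp.continuous_toLp 2 _).tendsto _).comp h1
  have hnorm : ∀ k, ∀ y ∈ Cc k, spart y ^ 2 = ρ ^ 2 - ‖xpart y‖ ^ 2 := by
    intro k y hy
    rcases hCU k hy with h | h <;> linarith [h.2]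
  have hseqs : ∀ y : ℕ → EuclProd n, (∀ k, y k ∈ Cc k) →
      Tendsto (fun k => spart (y k) ^ 2) atTop (𝓝 (spart p ^ 2)) := by
    intro y hy
    rw [show spart p ^ 2 = ρ ^ 2 - ‖xpart p‖ ^ 2 by linarith [hp.2]]
    simp_rw [fun k => hnorm k (y k) (hy k)]
    exact tendsto_const_nhds.sub ((hseq y hy).norm.pow 2)
  -- `s` does not vanish on the components for large `k`
  have hnz : ∀ᶠ k in atTop, ∀ y ∈ Cc k, spart y ≠ 0 := by
    have hch : ∀ k, ∃ z ∈ Cc k, spart z ≠ 0 → ∀ y ∈ Cc k, spart y ≠ 0 := by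
      intro k
      by_cases h : ∃ z ∈ Cc k, spart z = 0
      · obtain ⟨z, hz, hz0⟩ := h
        exact ⟨z, hz, fun h => absurd hz0 h⟩
      · push Not at h
        exact ⟨a k, haC k, fun _ => h⟩
    choose z hz hz' using hch
    have := (hseqs z hz).eventually_ne (pow_ne_zero 2 hs)
    filter_upwards [this] with k hk
    exact hz' k fun h0 => hk (by rw [h0]; simp)
  have hbC : ∀ k, b k ∈ Cc k := hconn
  have hsa : Tendsto (fun k => spart (a k)) atTop (𝓝 (spart p)) :=
    (continuous_spart.tendsto p).comp halim
  have hsgn : ∀ᶠ k in atTop, 0 < spart (b k) * spart p := by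
    have h1 : ∀ᶠ k in atTop, 0 < spart (a k) * spart p := by
      have := hsa.mul_const (spart p)
      exact this.eventually_const_lt (mul_self_pos.2 hs)
    filter_upwards [h1, hnz] with k h1 h2
    by_contra h3
    have hpre : IsPreconnected (Cc k) := isPreconnected_connectedComponentIn
    obtain ⟨y, hy, hy0⟩ := hpre.intermediate_value (hbC k) (haC k)
      (continuous_spart.mul_const (spart p)).continuousOn ⟨not_lt.1 h3, h1.le⟩
    exact h2 y hy ((mul_eq_zero.1 hy0).resolve_right hs)
  have hlim : Tendsto (fun k => ‖xpart (b k) - xpart p‖ ^ 2 + |spart (b k) ^ 2 - spart p ^ 2|)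
      atTop (𝓝 0) := by
    have h1 := (((hseq b hbC).sub_const (xpart p)).norm.pow 2).add
      (((hseqs b hbC).sub_const (spart p ^ 2)).abs)
    simpa using h1
  obtain ⟨k, hk1, hk2⟩ := ((hlim.eventually_lt_const (pow_pos hδ 2)).and hsgn).exists
  have h1 : (spart (b k) - spart p) ^ 2 ≤ |spart (b k) ^ 2 - spart p ^ 2| := by
    rw [← sq_abs, show spart (b k) ^ 2 - spart p ^ 2
      = (spart (b k) - spart p) * (spart (b k) + spart p) by ring, abs_mul, sq]
    refine mul_le_mul_of_nonneg_left ?_ (abs_nonneg _)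
    rw [← sq_le_sq]
    nlinarith
  have h2 := norm_sq_parts (b k - p)
  rw [xpart_sub, spart_sub] at h2
  have h3 := hbfar k
  have h4 : δ ^ 2 ≤ ‖b k - p‖ ^ 2 := pow_le_pow_left₀ hδ.le h3 2
  linarith
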